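/- Let T be a (possibly unbounded) linear operator in a separable Banach space X, and set D(T^∞) := ⋂_{n=0}^∞ D(T^n). Suppose: (1) there is a set Y_0 ⊆ D(T^∞), dense in X, and a mapping S : Y_0 → Y_0 such that (a) T S y = y for all y ∈ Y_0, (b) ∑_{n=1}^∞ S^n y converges unconditionally for all y ∈ Y_0, and (c) ∑_{n=1}^∞ T^n y converges unconditionally for all y ∈ Y_0; and (2) there is a bounded linear operator C on X such that (a) Im(C) ⊆ D(T^∞) and for every n ∈ ℕ the operator T^n C (defined on all of X) is bounded, (b) C commutes with T on D(T^∞) (i.e., C T x = T C x for all x ∈ D(T^∞)), and (c) Im(C) is dense in X. Then T is frequently hypercyclic. -/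

import Mathlib

open Filter Topology
open scoped Classical

/-- The lower density of a set of natural numbers. -/
noncomputable def lowerDensity (S : Set ℕ) : ℝ :=
  Filter.atTop.liminf fun N : ℕ =>
    ((Finset.Icc 1 N).filter (fun n => n ∈ S)).card / (N : ℝ)

/-- A series `∑_{k=1}^∞ x k` converges unconditionally. -/
def UncondConv {X : Type*} [AddCommGroup X] [Norm X] (x : ℕ → X) : Prop :=
  ∀ ε > (0:ℝ), ∃ N : ℕ, 1 ≤ N ∧ ∀ F : Finset ℕ, (∀ k ∈ F, N < k) → ‖∑ k ∈ F, x k‖ < ε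

/-- A (possibly unbounded) operator `T` with domain `D` is frequently hypercyclic. -/
def FreqHypercyclic {X : Type*} [TopologicalSpace X] (D : Set X) (T : X → X) : Prop :=
  ∃ f ∈ D, (∀ n : ℕ, 1 ≤ n → T^[n] f ∈ D) ∧
    ∀ U : Set X, IsOpen U → U.Nonempty → 0 < lowerDensity {n : ℕ | T^[n] f ∈ U}

theorem density_sets (N : ℕ → ℕ) : ∃ A : ℕ → Set ℕ,
    (∀ k, ∃ q : ℕ, 0 < q ∧ ∀ M : ℕ, M / q ≤ ((Finset.Icc 1 M).filter (fun n => n ∈ A k)).card) ∧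
    (∀ k n, n ∈ A k → N k < n) ∧
    (∀ k j n m, n ∈ A k → m ∈ A j → n < m → n + N k < m ∧ n + N j < m) ∧
    (∀ k j n, n ∈ A k → n ∈ A j → k = j) := by
  -- the exponents
  obtain ⟨g, hgmono, hgN⟩ : ∃ g : ℕ → ℕ, StrictMono g ∧ ∀ k, N k * 2 ^ k ≤ 2 ^ g k := by
    refine ⟨fun k => ∑ j ∈ Finset.range (k + 1), (N j + j + 1), ?_, ?_⟩
    · refine strictMono_nat_of_lt_succ fun k => ?_
      rw [Finset.sum_range_succ _ (k + 1)]
      omega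
    · intro k
      have h1 : N k ≤ 2 ^ N k := Nat.lt_two_pow_self.le
      calc N k * 2 ^ k ≤ 2 ^ N k * 2 ^ k := Nat.mul_le_mul_right _ h1
        _ = 2 ^ (N k + k) := by rw [pow_add]
        _ ≤ _ := by
          apply Nat.pow_le_pow_right (by norm_num)
          dsimp only
          rw [Finset.sum_range_succ]
          omega
  have hgk : ∀ k, k ≤ g k := fun k => hgmono.le_apply
  have hklt : ∀ k i : ℕ, 0 < i → 2 ^ g k ∣ i → k < i := by
    intro k i hi hd
    have h1 := Nat.le_of_dvd hi hd
    have h2 : k < 2 ^ k := Nat.lt_two_pow_self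
    have h3 : 2 ^ k ≤ 2 ^ g k := Nat.pow_le_pow_right (by norm_num) (hgk k)
    omega
  let w : ℕ → ℕ := fun j => ∑ k ∈ Finset.range j, if 2 ^ g k ∣ j then N k else 0
  have hw : ∀ k i : ℕ, 0 < i → 2 ^ g k ∣ i → N k ≤ w i := by
    intro k i hi hd
    have := Finset.single_le_sum (f := fun k => if 2 ^ g k ∣ i then N k else 0)
      (fun _ _ => Nat.zero_le _) (Finset.mem_range.2 (hklt k i hi hd))
    simpa [hd] using this
  have hwsum : ∀ i : ℕ, ∑ j ∈ Finset.Ioc 0 i, w j ≤ 2 * i := by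
    intro i
    have h1 : ∑ j ∈ Finset.Ioc 0 i, w j ≤
        ∑ j ∈ Finset.Ioc 0 i, ∑ k ∈ Finset.range i, if 2 ^ g k ∣ j then N k else 0 := by
      apply Finset.sum_le_sum
      intro j hj
      apply Finset.sum_le_sum_of_subset
      apply Finset.range_mono
      exact (Finset.mem_Ioc.1 hj).2
    have h2 : ∀ k, (∑ j ∈ Finset.Ioc 0 i, if 2 ^ g k ∣ j then N k else 0) = (i / 2 ^ g k) * N k := by
      intro k
      rw [← Finset.sum_filter, Finset.sum_const, Nat.Ioc_filter_dvd_card_eq_div, smul_eq_mul]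
    rw [Finset.sum_comm, Finset.sum_congr rfl (fun k _ => h2 k)] at h1
    have h3 : ((∑ k ∈ Finset.range i, (i / 2 ^ g k) * N k : ℕ) : ℝ) ≤ 2 * i := by
      push_cast
      calc ∑ k ∈ Finset.range i, (((i / 2 ^ g k : ℕ) : ℝ)) * (N k : ℝ)
          ≤ ∑ k ∈ Finset.range i, (i : ℝ) * (1 / 2) ^ k := by
            apply Finset.sum_le_sum
            intro k _
            have h4 : ((i / 2 ^ g k : ℕ) : ℝ) ≤ (i : ℝ) / 2 ^ g k := by
              have := @Nat.cast_div_le ℝ _ _ _ i (2 ^ g k)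
              simpa using this
            have h5 : (N k : ℝ) * 2 ^ k ≤ 2 ^ g k := by exact_mod_cast hgN k
            calc _ ≤ (i : ℝ) / 2 ^ g k * (2 ^ g k * (1 / 2) ^ k) := by
                  apply mul_le_mul h4 _ (by positivity) (by positivity)
                  rw [one_div, inv_pow, ← div_eq_mul_inv, le_div_iff₀ (by positivity)]
                  exact h5
              _ = _ := by field_simp
        _ = (i : ℝ) * ∑ k ∈ Finset.range i, (1 / 2) ^ k := by rw [Finset.mul_sum]
        _ ≤ (i : ℝ) * 2 := by
            apply mul_le_mul_of_nonneg_left _ (by positivity)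
            exact sum_geometric_two_le i
        _ = _ := by ring
    have h3' : ∑ k ∈ Finset.range i, (i / 2 ^ g k) * N k ≤ 2 * i := by exact_mod_cast h3
    exact h1.trans h3'
  let P : ℕ → ℕ := fun i => ∑ j ∈ Finset.range i, (2 * w j + 1)
  let p : ℕ → ℕ := fun i => P i + w i
  have hPs : ∀ i, P (i + 1) = P i + (2 * w i + 1) := fun i => Finset.sum_range_succ _ _
  have hPmono : Monotone P := by
    apply monotone_nat_of_le_succ
    intro i
    rw [hPs]; omega
  have hsep : ∀ i i', i < i' → p i + w i < p i' ∧ p i + w i' < p i' := by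
    intro i i' h
    have h1 : P (i + 1) ≤ P i' := hPmono h
    rw [hPs] at h1
    simp only [p]
    omega
  have hpmono : StrictMono p := fun i i' h => by have := hsep i i' h; omega
  have hpos : ∀ i, 0 < i → w i < p i := by
    intro i hi
    have := hsep 0 i hi
    omega
  have hPle : ∀ i, P (i + 1) = 2 * ∑ j ∈ Finset.Ioc 0 i, w j + (i + 1) := by
    intro i
    induction i with
    | zero => simp [P, w]
    | succ n ih =>
      rw [hPs, ih, Finset.sum_Ioc_succ_top (by omega)]
      ring
  have hple : ∀ i, 0 < i → p i ≤ 6 * i := by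
    intro i hi
    have h1 := hPle i
    have h2 := hwsum i
    rw [hPs] at h1
    simp only [p]
    omega
  refine ⟨fun k => Set.range fun t => p (2 ^ g k * (2 * t + 1)), ?_, ?_, ?_, ?_⟩
  · intro k
    have hq : 0 < 2 ^ g k := by positivity
    refine ⟨12 * 2 ^ g k, by positivity, fun M => ?_⟩
    have hinj : Function.Injective fun t => p (2 ^ g k * (2 * t + 1)) := by
      intro a b h
      have := hpmono.injective h
      have := Nat.eq_of_mul_eq_mul_left hq this
      omega
    rw [← Finset.card_range (M / (12 * 2 ^ g k)), ← Finset.card_image_of_injective _ hinj]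
    apply Finset.card_le_card
    intro n hn
    obtain ⟨t, ht, rfl⟩ := Finset.mem_image.1 hn
    have ht' := Finset.mem_range.1 ht
    have h1 : 0 < 2 ^ g k * (2 * t + 1) := by positivity
    have h2 := hple _ h1
    have h3 := hpos _ h1
    rw [Finset.mem_filter, Finset.mem_Icc]
    refine ⟨⟨by omega, h2.trans ?_⟩, ⟨t, rfl⟩⟩
    have h4 : (t + 1) * (12 * 2 ^ g k) ≤ M :=
      (Nat.le_div_iff_mul_le (by positivity)).1 ht'
    nlinarith
  · rintro k n ⟨t, rfl⟩
    have h1 : 0 < 2 ^ g k * (2 * t + 1) := by positivity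
    exact (hw k _ h1 (Dvd.intro _ rfl)).trans_lt (hpos _ h1)
  · rintro k j n m ⟨t, rfl⟩ ⟨s, rfl⟩ h
    have h0 := hpmono.lt_iff_lt.1 h
    have h1 : 0 < 2 ^ g k * (2 * t + 1) := by positivity
    have h2 : 0 < 2 ^ g j * (2 * s + 1) := by positivity
    have h3 := hw k _ h1 (Dvd.intro _ rfl)
    have h4 := hw j _ h2 (Dvd.intro _ rfl)
    have h5 := hsep _ _ h0
    dsimp only
    omega
  · rintro k j n ⟨t, rfl⟩ ⟨s, hs⟩
    have h0 := hpmono.injective hs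
    have key : ∀ a b t s : ℕ, a < b → 2 ^ b * (2 * s + 1) ≠ 2 ^ a * (2 * t + 1) := by
      intro a b t s hab h
      obtain ⟨c, rfl⟩ := Nat.exists_eq_add_of_lt hab
      rw [add_assoc, pow_add, mul_assoc] at h
      have := Nat.eq_of_mul_eq_mul_left (by positivity) h
      rw [pow_succ] at this
      have h6 : 2 ^ c * 2 * (2 * s + 1) = 2 * (2 ^ c * (2 * s + 1)) := by ring
      omega
    rcases lt_trichotomy (g k) (g j) with h | h | h
    · exact absurd h0 (key _ _ _ _ h)
    · exact hgmono.injective h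
    · exact absurd h0.symm (key _ _ _ _ h)

theorem lowerDensity_pos_of (B : Set ℕ) (q : ℕ) (hq : 0 < q)
    (h : ∀ M : ℕ, M / q ≤ ((Finset.Icc 1 M).filter (fun n => n ∈ B)).card) :
    0 < lowerDensity B := by
  have hq' : (0:ℝ) < q := by exact_mod_cast hq
  have hc : (0:ℝ) < 1 / (2 * q) := by positivity
  refine lt_of_lt_of_le hc ?_
  unfold lowerDensity
  refine le_liminf_of_le ?_ ?_
  · refine IsBoundedUnder.isCoboundedUnder_ge ⟨1, ?_⟩
    refine Filter.eventually_map.2 (Eventually.of_forall fun M => ?_)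
    have h1 : ((Finset.Icc 1 M).filter (fun n => n ∈ B)).card ≤ M := by
      refine (Finset.card_filter_le _ _).trans ?_
      simp
    have h2 : (((Finset.Icc 1 M).filter (fun n => n ∈ B)).card : ℝ) ≤ M := by exact_mod_cast h1
    exact div_le_one_of_le₀ h2 (by positivity)
  · filter_upwards [eventually_ge_atTop (2 * q)] with M hM
    have hMpos : (0:ℝ) < M := by
      have : 0 < M := by omega
      exact_mod_cast this
    rw [div_le_div_iff₀ (by positivity) hMpos, one_mul]
    have h1 := h M
    have h2 : M < q * (M / q + 1) := Nat.lt_mul_div_succ M hq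
    have h3 : 2 ≤ M / q := (Nat.le_div_iff_mul_le hq).2 hM
    have h4 : M ≤ ((Finset.Icc 1 M).filter (fun n => n ∈ B)).card * (2 * q) := by
      calc M ≤ q * (M / q + 1) := h2.le
        _ ≤ q * (2 * (M / q)) := Nat.mul_le_mul_left _ (by omega)
        _ = (M / q) * (2 * q) := by ring
        _ ≤ _ := Nat.mul_le_mul_right _ h1
    exact_mod_cast h4

theorem norm_le_of_hasSum_bound {ι X : Type*} [NormedAddCommGroup X] {f : ι → X} {s : X} {b : ℝ}
    (hf : HasSum f s) (h : ∀ G : Finset ι, ‖∑ i ∈ G, f i‖ ≤ b) : ‖s‖ ≤ b :=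
  le_of_tendsto (Filter.Tendsto.norm hf) (Eventually.of_forall h)

theorem UncondConv.summable {X : Type*} [NormedAddCommGroup X] [CompleteSpace X] {x : ℕ → X}
    (h : UncondConv x) : Summable x := by
  rw [summable_iff_vanishing_norm]
  intro ε hε
  obtain ⟨N, _, hN⟩ := h ε hε
  refine ⟨Finset.range (N + 1), fun t ht => hN t fun k hk => ?_⟩
  by_contra hcon
  exact Finset.disjoint_left.1 ht hk (Finset.mem_range.2 (by omega))

/-- Let `T` be a (possibly unbounded) linear operator in a separable
Banach space `X` (modelled as a total map that is linear on the submodule `D`), with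
`D(T^∞) = {x | T^n x ∈ D for all n}`.  Suppose (1) there is a dense set `Y₀ ⊆ D(T^∞)`
and `S : Y₀ → Y₀` with `T S y = y` and `∑ S^n y`, `∑ T^n y` unconditionally convergent
for all `y ∈ Y₀`; and (2) there is a bounded linear operator `C` on `X` with
`Im(C) ⊆ D(T^∞)`, all `T^n C` bounded, `C` commuting with `T` on `D(T^∞)`, and `Im(C)`
dense.  Then `T` is frequently hypercyclic. -/
theorem stmt11 {𝕜 X : Type*} [RCLike 𝕜] [NormedAddCommGroup X] [NormedSpace 𝕜 X]
    [CompleteSpace X] [TopologicalSpace.SeparableSpace X]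
    (D : Submodule 𝕜 X) (T : X → X)
    (hadd : ∀ x ∈ D, ∀ y ∈ D, T (x + y) = T x + T y)
    (hsmul : ∀ c : 𝕜, ∀ x ∈ D, T (c • x) = c • T x)
    -- (1) the dense set `Y₀ ⊆ D(T^∞)` and the map `S : Y₀ → Y₀`
    (Y₀ : Set X) (hY₀inf : ∀ y ∈ Y₀, ∀ n : ℕ, T^[n] y ∈ D) (hY₀dense : Dense Y₀)
    (S : X → X) (hS : ∀ y ∈ Y₀, S y ∈ Y₀)
    (h1a : ∀ y ∈ Y₀, T (S y) = y)
    (h1b : ∀ y ∈ Y₀, UncondConv fun n => S^[n] y)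
    (h1c : ∀ y ∈ Y₀, UncondConv fun n => T^[n] y)
    -- (2) the bounded operator `C`
    (C : X →L[𝕜] X)
    (h2a₁ : ∀ x : X, ∀ n : ℕ, T^[n] (C x) ∈ D)
    (h2a₂ : ∀ n : ℕ, ∃ M : ℝ, ∀ x : X, ‖T^[n] (C x)‖ ≤ M * ‖x‖)
    (h2b : ∀ x : X, (∀ n : ℕ, T^[n] x ∈ D) → C (T x) = T (C x))
    (h2c : DenseRange C) :
    FreqHypercyclic (D : Set X) T := by
  -- powers of `T` composed with `C` are continuous linear maps
  have hLadd : ∀ n x x', T^[n] (C (x + x')) = T^[n] (C x) + T^[n] (C x') := by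
    intro n x x'
    induction n with
    | zero => simp
    | succ n ih =>
      rw [Function.iterate_succ_apply', ih, hadd _ (h2a₁ x n) _ (h2a₁ x' n),
        ← Function.iterate_succ_apply' T, ← Function.iterate_succ_apply' T]
  have hLsmul : ∀ n (c : 𝕜) x, T^[n] (C (c • x)) = c • T^[n] (C x) := by
    intro n c x
    induction n with
    | zero => simp
    | succ n ih =>
      rw [Function.iterate_succ_apply', ih, hsmul _ _ (h2a₁ x n),
        ← Function.iterate_succ_apply' T]
  have hL : ∀ n, ∃ L : X →L[𝕜] X, ∀ x, L x = T^[n] (C x) := by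
    intro n
    obtain ⟨M, hM⟩ := h2a₂ n
    exact ⟨LinearMap.mkContinuous ⟨⟨fun x => T^[n] (C x), hLadd n⟩, hLsmul n⟩ M hM,
      fun x => rfl⟩
  choose L hLap using hL
  -- commutation
  have hcomm : ∀ n x, (∀ i : ℕ, T^[i] x ∈ D) → T^[n] (C x) = C (T^[n] x) := by
    intro n
    induction n with
    | zero => intro x _; rfl
    | succ n ih =>
      intro x hx
      rw [Function.iterate_succ_apply, Function.iterate_succ_apply, ← h2b x hx, ih]
      intro i
      rw [← Function.iterate_succ_apply T]
      exact hx (i + 1)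
  have hSn : ∀ n, ∀ y ∈ Y₀, S^[n] y ∈ Y₀ := by
    intro n
    induction n with
    | zero => intro y hy; exact hy
    | succ n ih => intro y hy; rw [Function.iterate_succ_apply]; exact ih _ (hS y hy)
  have hTS : ∀ n, ∀ y ∈ Y₀, T^[n] (S^[n] y) = y := by
    intro n
    induction n with
    | zero => intro y _; rfl
    | succ n ih =>
      intro y hy
      rw [Function.iterate_succ_apply, Function.iterate_succ_apply' S, h1a _ (hSn n y hy), ih y hy]
  have hTSge : ∀ n m, m ≤ n → ∀ y ∈ Y₀, T^[n] (S^[m] y) = T^[n - m] y := by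
    intro n m h y hy
    obtain ⟨d, rfl⟩ := Nat.exists_eq_add_of_le' h
    rw [Function.iterate_add_apply, hTS m y hy, Nat.add_sub_cancel]
  have hTSle : ∀ n m, n ≤ m → ∀ y ∈ Y₀, T^[n] (S^[m] y) = S^[m - n] y := by
    intro n m h y hy
    obtain ⟨d, rfl⟩ := Nat.exists_eq_add_of_le h
    rw [Function.iterate_add_apply, hTS n _ (hSn d y hy), Nat.add_sub_cancel_left]
  -- dense sequence in `Y₀`
  haveI : Nonempty Y₀ := hY₀dense.nonempty.to_subtype
  obtain ⟨z, hz⟩ := TopologicalSpace.exists_dense_seq Y₀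
  have hzd : DenseRange (fun i => (z i : X)) :=
    (hY₀dense.denseRange_val).comp hz continuous_subtype_val
  have hCz : DenseRange (fun i => C (z i : X)) := h2c.comp hzd C.continuous
  let y : ℕ → X := fun k => z (Nat.unpair k).1
  have hy : ∀ k, y k ∈ Y₀ := fun k => (z _).2
  -- the gaps
  have hN : ∀ K : ℕ, ∃ N : ℕ, ∀ k ≤ K, ∀ F : Finset ℕ, (∀ i ∈ F, N < i) →
      ‖∑ i ∈ F, S^[i] (y k)‖ ≤ (1 / 4 : ℝ) ^ K ∧ ‖∑ i ∈ F, T^[i] (y k)‖ ≤ (1 / 4 : ℝ) ^ K := by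
    intro K
    have hε : (0:ℝ) < (1 / 4 : ℝ) ^ K := by positivity
    choose N1 _ hN1 using fun k => h1b (y k) (hy k) _ hε
    choose N2 _ hN2 using fun k => h1c (y k) (hy k) _ hε
    refine ⟨∑ k ∈ Finset.range (K + 1), (N1 k + N2 k), fun k hk F hF => ?_⟩
    have h1 : N1 k + N2 k ≤ ∑ k ∈ Finset.range (K + 1), (N1 k + N2 k) :=
      Finset.single_le_sum (f := fun k => N1 k + N2 k) (fun _ _ => Nat.zero_le _)
        (Finset.mem_range.2 (by omega))
    exact ⟨(hN1 k F fun i hi => by have := hF i hi; omega).le,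
      (hN2 k F fun i hi => by have := hF i hi; omega).le⟩
  choose N hN using hN
  obtain ⟨A, hAd, hAN, hAsep, hAdisj⟩ := density_sets N
  -- the pieces
  let a : ℕ → ℕ → X := fun k => (A k).indicator fun m => S^[m] (y k)
  have ha : ∀ k, Summable (a k) := fun k => ((h1b (y k) (hy k)).summable).indicator (A k)
  let x : ℕ → X := fun k => ∑' m, a k m
  have hax : ∀ k, HasSum (a k) (x k) := fun k => (ha k).hasSum
  have hxn : ∀ k, ‖x k‖ ≤ (1 / 4 : ℝ) ^ k := by
    intro k
    refine norm_le_of_hasSum_bound (hax k) fun G => ?_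
    have : ∑ m ∈ G, a k m = ∑ m ∈ G.filter (fun m => m ∈ A k), S^[m] (y k) := by
      rw [Finset.sum_filter]
      rfl
    rw [this]
    exact (hN k k le_rfl _ fun i hi => hAN k i (Finset.mem_filter.1 hi).2).1
  have hxs : Summable x :=
    Summable.of_norm_bounded (summable_geometric_of_lt_one (by norm_num) (by norm_num)) hxn
  -- the main estimate for each piece
  have hpiece : ∀ j n k, n ∈ A j →
      ‖L n (x k) - (if k = j then C (y j) else 0)‖ ≤ ‖C‖ * (2 * (1 / 4 : ℝ) ^ (max k j)) := by
    intro j n k hn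
    have hs1 : HasSum (fun m => L n (a k m)) (L n (x k)) := (L n).hasSum (hax k)
    have hs2 : HasSum (fun m => if m = n then (if k = j then C (y j) else 0) else 0)
        (if k = j then C (y j) else 0) := hasSum_ite_eq n _
    refine norm_le_of_hasSum_bound (hs1.sub hs2) fun G => ?_
    let G1 := G.filter (fun m => m ∈ A k ∧ m < n)
    let G2 := G.filter (fun m => m ∈ A k ∧ n < m)
    have hterm : ∀ m, L n (a k m) - (if m = n then (if k = j then C (y j) else 0) else 0) =
        C ((if m ∈ A k ∧ m < n then T^[n - m] (y k) else 0) +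
          (if m ∈ A k ∧ n < m then S^[m - n] (y k) else 0)) := by
      intro m
      by_cases hm : m ∈ A k
      · have h1 : L n (a k m) = C (T^[n] (S^[m] (y k))) := by
          rw [hLap]
          simp only [a, Set.indicator_of_mem hm]
          exact hcomm n _ (hY₀inf _ (hSn m _ (hy k)))
        rw [h1]
        rcases lt_trichotomy m n with h | h | h
        · rw [hTSge n m h.le _ (hy k)]
          simp [hm, h, h.ne, h.not_gt]
        · subst h
          have hkj := hAdisj _ _ _ hm hn
          subst hkj
          simp [hTS m _ (hy k)]
        · rw [hTSle n m h.le _ (hy k)]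
          simp [hm, h, h.ne', h.not_gt]
      · have h1 : a k m = 0 := Set.indicator_of_notMem hm _
        have h2 : ¬ (m = n ∧ k = j) := by
          rintro ⟨rfl, rfl⟩
          exact hm hn
        rw [h1]
        by_cases hmn : m = n
        · have : k ≠ j := fun h => h2 ⟨hmn, h⟩
          simp [hm, this]
        · simp [hm, hmn]
    have hsum : ∑ m ∈ G, (L n (a k m) - (if m = n then (if k = j then C (y j) else 0) else 0)) =
        C (∑ m ∈ G1, T^[n - m] (y k) + ∑ m ∈ G2, S^[m - n] (y k)) := by
      rw [Finset.sum_congr rfl fun m _ => hterm m, ← map_sum, Finset.sum_add_distrib]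
      simp only [G1, G2, Finset.sum_filter]
    rw [hsum]
    have hdist : ∀ m ∈ A k, (m < n → N (max k j) < n - m) ∧ (n < m → N (max k j) < m - n) := by
      intro m hm
      rcases max_choice k j with h | h <;> rw [h] <;>
      exact ⟨fun h => by have := hAsep k j m n hm hn h; omega,
        fun h => by have := hAsep j k n m hn hm h; omega⟩
    have hb1 : ‖∑ m ∈ G1, T^[n - m] (y k)‖ ≤ (1 / 4 : ℝ) ^ (max k j) := by
      have himg : ∑ i ∈ G1.image (fun m => n - m), T^[i] (y k) = ∑ m ∈ G1, T^[n - m] (y k) := by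
        apply Finset.sum_image
        intro m1 h1 m2 h2 h
        have h1' := (Finset.mem_filter.1 (Finset.mem_coe.1 h1)).2.2
        have h2' := (Finset.mem_filter.1 (Finset.mem_coe.1 h2)).2.2
        dsimp only at h
        omega
      rw [← himg]
      refine (hN (max k j) k (le_max_left _ _) _ fun i hi => ?_).2
      obtain ⟨m, hm, rfl⟩ := Finset.mem_image.1 hi
      have hm' := (Finset.mem_filter.1 hm).2
      exact (hdist m hm'.1).1 hm'.2
    have hb2 : ‖∑ m ∈ G2, S^[m - n] (y k)‖ ≤ (1 / 4 : ℝ) ^ (max k j) := by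
      have himg : ∑ i ∈ G2.image (fun m => m - n), S^[i] (y k) = ∑ m ∈ G2, S^[m - n] (y k) := by
        apply Finset.sum_image
        intro m1 h1 m2 h2 h
        have h1' := (Finset.mem_filter.1 (Finset.mem_coe.1 h1)).2.2
        have h2' := (Finset.mem_filter.1 (Finset.mem_coe.1 h2)).2.2
        dsimp only at h
        omega
      rw [← himg]
      refine (hN (max k j) k (le_max_left _ _) _ fun i hi => ?_).1
      obtain ⟨m, hm, rfl⟩ := Finset.mem_image.1 hi
      have hm' := (Finset.mem_filter.1 hm).2
      exact (hdist m hm'.1).2 hm'.2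
    refine (C.le_opNorm _).trans (mul_le_mul_of_nonneg_left ?_ (norm_nonneg _))
    refine (norm_add_le _ _).trans ?_
    linarith
  -- the vector
  have hmain : ∀ j n, n ∈ A j → ‖T^[n] (C (∑' k, x k)) - C (y j)‖ ≤ 4 * ‖C‖ * (1 / 2 : ℝ) ^ j := by
    intro j n hn
    have hs1 : HasSum (fun k => L n (x k)) (L n (∑' k, x k)) := (L n).hasSum hxs.hasSum
    have hs2 : HasSum (fun k => if k = j then C (y j) else 0) (C (y j)) := hasSum_ite_eq j _
    have hs := hs1.sub hs2
    rw [← hLap, ← hs.tsum_eq]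
    have hg : HasSum (fun k => ‖C‖ * 2 * (1 / 2 : ℝ) ^ j * (1 / 2 : ℝ) ^ k)
        (‖C‖ * 2 * (1 / 2 : ℝ) ^ j * 2) := hasSum_geometric_two.mul_left _
    refine (tsum_of_norm_bounded hg fun k => (hpiece j n k hn).trans ?_).trans (le_of_eq (by ring))
    have h4 : (1 / 4 : ℝ) ^ (max k j) ≤ (1 / 2 : ℝ) ^ j * (1 / 2 : ℝ) ^ k := by
      rw [show (1 / 4 : ℝ) = (1 / 2) ^ 2 by norm_num, ← pow_mul, ← pow_add]
      apply pow_le_pow_of_le_one (by norm_num) (by norm_num)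
      have := le_max_left k j
      have := le_max_right k j
      omega
    have := mul_le_mul_of_nonneg_left h4 (norm_nonneg C)
    linarith
  refine ⟨C (∑' k, x k), h2a₁ _ 0, fun n _ => h2a₁ _ n, fun U hU hUne => ?_⟩
  obtain ⟨i, hi⟩ := hCz.exists_mem_open hU hUne
  obtain ⟨r, hr, hball⟩ := Metric.isOpen_iff.1 hU _ hi
  have hlim : Tendsto (fun j : ℕ => 4 * ‖C‖ * (1 / 2 : ℝ) ^ j) atTop (𝓝 0) := by
    have := (tendsto_pow_atTop_nhds_zero_of_lt_one (r := (1 / 2 : ℝ)) (by norm_num)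
      (by norm_num)).const_mul (4 * ‖C‖)
    simpa using this
  obtain ⟨J, hJ⟩ := (hlim.eventually (gt_mem_nhds hr)).exists_forall_of_atTop
  have hj : J ≤ Nat.pair i J := Nat.right_le_pair i J
  have hyj : y (Nat.pair i J) = z i := by simp [y]
  obtain ⟨q, hq, hcount⟩ := hAd (Nat.pair i J)
  refine lowerDensity_pos_of _ q hq fun M => (hcount M).trans (Finset.card_le_card ?_)
  intro n hn
  rw [Finset.mem_filter] at hn ⊢
  refine ⟨hn.1, hball ?_⟩
  rw [Metric.mem_ball, dist_eq_norm, ← hyj]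
  exact (hmain _ n hn.2).trans_lt (hJ _ hj)
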